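/- Fix α with −1 < α < ∞, a ∈ D, and a positive integer n; put C_{α,j} = Γ(α+2+j)/(Γ(α+2)·j!). Define K_A(z,w) = 1/(1−z·conj(w))^{α+2} − ((1−|a|²)^{α+2}/((1−z·conj(a))^{α+2}(1−a·conj(w))^{α+2}))·Σ_{j=0}^{n−1} C_{α,j}·((z−a)/(1−z·conj(a)))^j·((conj(w)−conj(a))/(1−a·conj(w)))^j. Then for every w ∈ D, the function K_A(·,w) belongs to A²_α(D), vanishes at a to order at least n, and for every f ∈ A²_α(D) vanishing at a to order at least n, ∫_D f(z)·conj(K_A(z,w))·(α+1)(1−|z|²)^α dΣ(z) = f(w). -/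

import Mathlib

open Complex MeasureTheory Metric Set

noncomputable section

/-- The open unit disk in ℂ. -/
def unitDisk : Set ℂ := Metric.ball 0 1

/-- The closed unit disk in ℂ. -/
def closedDisk : Set ℂ := Metric.closedBall 0 1

/-- The unit circle in ℂ. -/
def unitCircle : Set ℂ := Metric.sphere 0 1

/-- The normalized area measure dΣ = dx dy / π on ℂ. -/
def dSigma : Measure ℂ := (ENNReal.ofReal (1 / Real.pi)) • (volume : Measure ℂ)

/-- The normalized Laplacian Δ = (1/4)(∂²ₓ + ∂²_y) of a real-valued function on ℂ. -/
def lapR (u : ℂ → ℝ) (z : ℂ) : ℝ :=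
  (1/4) * (fderiv ℝ (fun w => fderiv ℝ u w 1) z 1
    + fderiv ℝ (fun w => fderiv ℝ u w Complex.I) z Complex.I)

/-- The normalized Laplacian Δ = (1/4)(∂²ₓ + ∂²_y) of a complex-valued function on ℂ. -/
def lapC (u : ℂ → ℂ) (z : ℂ) : ℂ :=
  (1/4) * (fderiv ℝ (fun w => fderiv ℝ u w 1) z 1
    + fderiv ℝ (fun w => fderiv ℝ u w Complex.I) z Complex.I)

/-- Membership in the weighted Bergman space A²(𝔻, ω): holomorphic on the unit disk
and square integrable against the weight ω with respect to dΣ. -/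
def MemA2 (ω : ℂ → ℝ) (f : ℂ → ℂ) : Prop :=
  DifferentiableOn ℂ f unitDisk ∧
    IntegrableOn (fun z => ‖f z‖ ^ 2 * ω z) unitDisk dSigma

/-- `k` reproduces at `w` for the weight `ω`. -/
def Reproduces (ω : ℂ → ℝ) (k : ℂ → ℂ) (w : ℂ) : Prop :=
  MemA2 ω k ∧ ∀ f : ℂ → ℂ, MemA2 ω f →
    ∫ z in unitDisk, f z * (starRingEnd ℂ) (k z) * (ω z : ℂ) ∂dSigma = f w

/-- A bounded (complex-valued) harmonic function on the unit disk. -/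
def BoundedHarmonicC (h : ℂ → ℂ) : Prop :=
  ContDiffOn ℝ 2 h unitDisk ∧ (∀ z ∈ unitDisk, lapC h z = 0) ∧
    ∃ M : ℝ, ∀ z ∈ unitDisk, ‖h z‖ ≤ M

/-- A bounded real-valued harmonic function on the unit disk. -/
def BoundedHarmonicR (h : ℂ → ℝ) : Prop :=
  ContDiffOn ℝ 2 h unitDisk ∧ (∀ z ∈ unitDisk, lapR h z = 0) ∧
    ∃ M : ℝ, ∀ z ∈ unitDisk, |h z| ≤ M

lemma mv0 (H : ℂ → ℂ) (hH : DifferentiableOn ℂ H unitDisk) (h0 : H 0 = 0) (ρ : ℝ → ℝ) :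
    ∫ z in unitDisk, H z * (ρ ‖z‖ : ℂ) = 0 := by
  have hms : MeasurableSet unitDisk := measurableSet_ball
  rw [← integral_indicator hms, ← Complex.integral_comp_polarCoord_symm]
  by_cases hi : IntegrableOn (fun p : ℝ × ℝ => p.1 • (unitDisk.indicator (fun z => H z * (ρ ‖z‖ : ℂ)))
      (Complex.polarCoord.symm p)) polarCoord.target
  swap
  · exact integral_undef hi
  rw [polarCoord_target] at hi ⊢
  rw [Measure.volume_eq_prod] at hi ⊢
  rw [setIntegral_prod _ hi]
  apply integral_eq_zero_of_ae
  filter_upwards [ae_restrict_mem measurableSet_Ioi] with r hr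
  have hr : 0 < r := hr
  by_cases hr1 : r < 1
  swap
  · have : ∀ y : ℝ, Complex.polarCoord.symm (r, y) ∉ unitDisk := by
      intro y
      simp [unitDisk, abs_of_pos hr]
      linarith
    simp only [Set.indicator_of_notMem (this _)]
    simp
  have hm : ∀ y : ℝ, Complex.polarCoord.symm (r, y) ∈ unitDisk := by
    intro y
    simp [unitDisk, abs_of_pos hr]
    linarith
  have hca := DiffContOnCl.circleAverage (f := H) (c := 0) (R := r) (by
    apply DifferentiableOn.diffContOnCl
    refine hH.mono ?_
    rw [abs_of_pos hr, closure_ball _ hr.ne']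
    exact closedBall_subset_ball hr1)
  rw [h0, Real.circleAverage_def] at hca
  have h2 : ∫ θ in (0:ℝ)..2 * Real.pi, H (circleMap 0 r θ) = 0 := by
    simpa [Real.pi_ne_zero] using hca
  have hper : Function.Periodic (fun θ => H (circleMap 0 r θ)) (2 * Real.pi) := by
    intro θ
    simp [periodic_circleMap 0 r θ]
  have h3 := hper.intervalIntegral_add_eq 0 (-Real.pi)
  rw [zero_add, h2, intervalIntegral.integral_of_le (by linarith [Real.pi_pos]), integral_Ioc_eq_integral_Ioo] at h3
  have e : -Real.pi + 2 * Real.pi = Real.pi := by ring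
  rw [e] at h3
  have : ∀ y : ℝ, r • (unitDisk.indicator (fun z => H z * (ρ ‖z‖ : ℂ))) (Complex.polarCoord.symm (r, y)) = (r * ρ r : ℂ) * H (circleMap 0 r y) := by
    intro y
    rw [Set.indicator_of_mem (hm y), Complex.norm_polarCoord_symm]
    have : Complex.polarCoord.symm (r, y) = circleMap 0 r y := by
      rw [Complex.polarCoord_symm_apply, circleMap, exp_mul_I]
      simp
    rw [this, abs_of_pos hr, Complex.real_smul]
    ring
  simp only [this]
  rw [integral_const_mul, ← h3]
  simp

lemma weight_rad (α : ℝ) (hα : -1 < α) : IntegrableOn (fun r : ℝ => r * (1 - r ^ 2) ^ α) (Ioc 0 1) ∧ ∫ r in (0:ℝ)..1, r * (1 - r ^ 2) ^ α = 1 / (2 * (α + 1)) := by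
  have hα1 : 0 < α + 1 := by linarith
  have hc : ContinuousOn (fun r : ℝ => -(1 - r ^ 2) ^ (α + 1) / (2 * (α + 1))) (Icc 0 1) := by
    refine (ContinuousOn.neg (ContinuousOn.rpow_const (by fun_prop) ?_)).div_const _
    intro x _; right; exact hα1.le
  have hd : ∀ x ∈ Ioo (0:ℝ) 1, HasDerivAt (fun r : ℝ => -(1 - r ^ 2) ^ (α + 1) / (2 * (α + 1))) (x * (1 - x ^ 2) ^ α) x := by
    intro x hx
    have hp : 0 < 1 - x ^ 2 := by nlinarith [hx.1, hx.2]
    have h1 : HasDerivAt (fun r : ℝ => 1 - r ^ 2) (-(2 * x)) x := by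
      simpa using (hasDerivAt_pow 2 x).const_sub 1
    have := ((h1.rpow_const (p := α + 1) (Or.inl hp.ne')).neg).div_const (2 * (α + 1))
    have e : x * (1 - x ^ 2) ^ α = -(-(2 * x) * (α + 1) * (1 - x ^ 2) ^ (α + 1 - 1)) / (2 * (α + 1)) := by
      rw [add_sub_cancel_right]
      field_simp
    rw [e]
    exact this
  have hn : ∀ x ∈ Ioo (0:ℝ) 1, 0 ≤ x * (1 - x ^ 2) ^ α := by
    intro x hx
    have hp : 0 < 1 - x ^ 2 := by nlinarith [hx.1, hx.2]
    have := hx.1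
    positivity
  have hi := intervalIntegral.integrableOn_deriv_of_nonneg hc hd hn
  refine ⟨hi, ?_⟩
  rw [intervalIntegral.integral_eq_sub_of_hasDerivAt_of_le zero_le_one hc hd
    ((intervalIntegrable_iff_integrableOn_Ioc_of_le zero_le_one).2 hi)]
  simp [Real.zero_rpow hα1.ne']
  field_simp

lemma weight_int (α : ℝ) (hα : -1 < α) :
    IntegrableOn (fun z : ℂ => (1 - ‖z‖ ^ 2) ^ α) unitDisk ∧
    ∫ z in unitDisk, (1 - ‖z‖ ^ 2) ^ α = Real.pi / (α + 1) := by
  obtain ⟨h1, h2⟩ := weight_rad α hα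
  have hα1 : 0 < α + 1 := by linarith
  constructor
  · unfold unitDisk
    rw [integrableOn_fun_norm_addHaar volume (f := fun r => (1 - r ^ 2) ^ α)]
    simpa using h1.mono_set Ioo_subset_Ioc_self
  · have : ∀ z : ℂ, unitDisk.indicator (fun z : ℂ => (1 - ‖z‖ ^ 2) ^ α) z = (Iio (1:ℝ)).indicator (fun r => (1 - r ^ 2) ^ α) ‖z‖ := by
      intro z
      by_cases hz : ‖z‖ < 1 <;> simp [unitDisk, hz, Set.indicator]
    have hms : MeasurableSet unitDisk := measurableSet_ball
    rw [← integral_indicator hms]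
    simp only [this]
    rw [integral_fun_norm_addHaar volume (fun x => (Iio (1:ℝ)).indicator (fun r => (1 - r ^ 2) ^ α) x)]
    have e : ∀ r : ℝ, r ^ (Module.finrank ℝ ℂ - 1) • (Iio (1:ℝ)).indicator (fun r => (1 - r ^ 2) ^ α) r = (Iio (1:ℝ)).indicator (fun r => r * (1 - r ^ 2) ^ α) r := by
      intro r
      by_cases hz : r < 1 <;> simp [hz, Set.indicator]
    simp only [e]
    rw [integral_indicator measurableSet_Iio, Measure.restrict_restrict measurableSet_Iio, 
      Iio_inter_Ioi, ← integral_Ioc_eq_integral_Ioo, ← intervalIntegral.integral_of_le zero_le_one, h2]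
    simp [Measure.real]
    field_simp

def mob (a ζ : ℂ) : ℂ := (ζ + a) / (1 + (starRingEnd ℂ) a * ζ)

lemma mem_uD {z : ℂ} : z ∈ unitDisk ↔ ‖z‖ < 1 := by simp [unitDisk]

lemma re_pos_of {u : ℂ} (h : ‖u‖ < 1) : 0 < (1 - u).re := by
  have := (abs_le.1 (Complex.abs_re_le_norm u)).2
  simp; linarith

lemma norm_mul_lt {z w : ℂ} (hz : ‖z‖ ≤ 1) (hw : ‖w‖ < 1) : ‖z * (starRingEnd ℂ) w‖ < 1 := by
  rw [norm_mul, RCLike.norm_conj]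
  nlinarith [norm_nonneg z, norm_nonneg w]

lemma ne_of_re_pos {u : ℂ} (h : 0 < u.re) : u ≠ 0 := by
  rintro rfl; simp at h

lemma den_ne {a ζ : ℂ} (ha : ‖a‖ < 1) (hz : ‖ζ‖ < 1) : 1 + (starRingEnd ℂ) a * ζ ≠ 0 := by
  have h := norm_mul_lt hz.le (w := -a) (by simpa using ha)
  have := ne_of_re_pos (re_pos_of h)
  convert this using 1
  simp; ring

lemma one_sub_norm_mob {a ζ : ℂ} (ha : ‖a‖ < 1) (hz : ‖ζ‖ < 1) :
    1 - ‖mob a ζ‖ ^ 2 = (1 - ‖a‖ ^ 2) * (1 - ‖ζ‖ ^ 2) / ‖1 + (starRingEnd ℂ) a * ζ‖ ^ 2 := by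
  have h := den_ne ha hz
  have h2 : ‖1 + (starRingEnd ℂ) a * ζ‖ ≠ 0 := by simpa using h
  rw [mob, norm_div, div_pow, eq_div_iff (pow_ne_zero 2 h2), sub_mul, div_mul_cancel₀ _ (pow_ne_zero 2 h2)]
  simp only [← Complex.normSq_eq_norm_sq, Complex.normSq_apply]
  simp
  ring

lemma mob_mem {a ζ : ℂ} (ha : ‖a‖ < 1) (hz : ‖ζ‖ < 1) : ‖mob a ζ‖ < 1 := by
  have h := den_ne ha hz
  have h1 := one_sub_norm_mob ha hz
  have : 0 < (1 - ‖a‖ ^ 2) * (1 - ‖ζ‖ ^ 2) / ‖1 + (starRingEnd ℂ) a * ζ‖ ^ 2 := by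
    have h2 : 0 < ‖1 + (starRingEnd ℂ) a * ζ‖ := by simpa using h
    have h3 : 0 < 1 - ‖a‖ ^ 2 := by nlinarith [norm_nonneg a]
    have h4 : 0 < 1 - ‖ζ‖ ^ 2 := by nlinarith [norm_nonneg ζ]
    positivity
  nlinarith [norm_nonneg (mob a ζ)]

lemma aa_eq (a : ℂ) : (1 : ℂ) - a * (starRingEnd ℂ) a = ((1 - ‖a‖ ^ 2 : ℝ) : ℂ) := by
  rw [Complex.mul_conj, Complex.normSq_eq_norm_sq]; push_cast; ring

lemma aa_ne {a : ℂ} (ha : ‖a‖ < 1) : (1 : ℂ) - a * (starRingEnd ℂ) a ≠ 0 := by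
  have h3 : 0 < 1 - ‖a‖ ^ 2 := by nlinarith [norm_nonneg a]
  rw [aa_eq]; exact_mod_cast h3.ne'

lemma one_sub_mob {a ζ : ℂ} (ha : ‖a‖ < 1) (hz : ‖ζ‖ < 1) :
    1 - mob a ζ * (starRingEnd ℂ) a = (1 - a * (starRingEnd ℂ) a) / (1 + (starRingEnd ℂ) a * ζ) := by
  have h := den_ne ha hz
  have h' : 1 + ζ * (starRingEnd ℂ) a ≠ 0 := by rwa [mul_comm] at h
  rw [mob]; field_simp; ring

lemma mob_inv {a ζ : ℂ} (ha : ‖a‖ < 1) (hz : ‖ζ‖ < 1) : mob (-a) (mob a ζ) = ζ := by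
  have h := den_ne ha hz
  have h1 := one_sub_mob ha hz
  have h2 := aa_ne ha
  have : mob (-a) (mob a ζ) = (mob a ζ - a) / (1 - mob a ζ * (starRingEnd ℂ) a) := by
    rw [mob]; simp; ring
  have h' : 1 + ζ * (starRingEnd ℂ) a ≠ 0 := by rwa [mul_comm] at h
  rw [this, h1, mob]
  field_simp
  ring

lemma mob_hasDeriv {a ζ : ℂ} (ha : ‖a‖ < 1) (hz : ‖ζ‖ < 1) :
    HasDerivAt (mob a) ((1 - a * (starRingEnd ℂ) a) / (1 + (starRingEnd ℂ) a * ζ) ^ 2) ζ := by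
  have h := den_ne ha hz
  have h1 : HasDerivAt (fun ζ : ℂ => ζ + a) 1 ζ := (hasDerivAt_id ζ).add_const a
  have h2 : HasDerivAt (fun ζ : ℂ => 1 + (starRingEnd ℂ) a * ζ) ((starRingEnd ℂ) a) ζ := by
    simpa using ((hasDerivAt_id ζ).const_mul ((starRingEnd ℂ) a)).const_add 1
  have e : (1 - a * (starRingEnd ℂ) a) / (1 + (starRingEnd ℂ) a * ζ) ^ 2 = 
     (1 * (1 + (starRingEnd ℂ) a * ζ) - (ζ + a) * (starRingEnd ℂ) a) / (1 + (starRingEnd ℂ) a * ζ) ^ 2 := by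
    congr 1; ring
  rw [e]
  exact h1.div h2 h

lemma mob_image {a : ℂ} (ha : ‖a‖ < 1) : mob a '' unitDisk = unitDisk := by
  ext z
  constructor
  · rintro ⟨y, hy, rfl⟩
    exact mem_uD.2 (mob_mem ha (mem_uD.1 hy))
  · intro hz
    have ha' : ‖-a‖ < 1 := by simpa using ha
    refine ⟨mob (-a) z, mem_uD.2 (mob_mem ha' (mem_uD.1 hz)), ?_⟩
    simpa using mob_inv ha' (mem_uD.1 hz)

lemma mob_injOn {a : ℂ} (ha : ‖a‖ < 1) : InjOn (mob a) unitDisk := by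
  intro x hx y hy h
  rw [← mob_inv ha (mem_uD.1 hx), h, mob_inv ha (mem_uD.1 hy)]

def dmob (a ζ : ℂ) : ℂ := (1 - a * (starRingEnd ℂ) a) / (1 + (starRingEnd ℂ) a * ζ) ^ 2

lemma det_aux (d : ℂ) : |((ContinuousLinearMap.toSpanSingleton ℂ d).restrictScalars ℝ : ℂ →L[ℝ] ℂ).det| = ‖d‖ ^ 2 := by
  have : ((ContinuousLinearMap.toSpanSingleton ℂ d).restrictScalars ℝ : ℂ →L[ℝ] ℂ).det
    = LinearMap.det ((LinearMap.toSpanSingleton ℂ ℂ d).restrictScalars ℝ) := rfl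
  rw [this, LinearMap.det_restrictScalars, Algebra.norm_complex_apply, Complex.normSq_eq_norm_sq]
  simp

lemma cov {a : ℂ} (ha : ‖a‖ < 1) (g : ℂ → ℂ) :
    (IntegrableOn g unitDisk ↔ IntegrableOn (fun ζ => ‖dmob a ζ‖ ^ 2 • g (mob a ζ)) unitDisk) ∧
    ∫ z in unitDisk, g z = ∫ ζ in unitDisk, ‖dmob a ζ‖ ^ 2 • g (mob a ζ) := by
  have hms : MeasurableSet unitDisk := measurableSet_ball
  have hd : ∀ x ∈ unitDisk, HasFDerivWithinAt (mob a) ((ContinuousLinearMap.toSpanSingleton ℂ (dmob a x)).restrictScalars ℝ : ℂ →L[ℝ] ℂ) unitDisk x := by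
    intro x hx
    exact ((mob_hasDeriv ha (mem_uD.1 hx)).hasFDerivAt.restrictScalars ℝ).hasFDerivWithinAt
  have h1 := integrableOn_image_iff_integrableOn_abs_det_fderiv_smul volume hms hd (mob_injOn ha) g
  have h2 := integral_image_eq_integral_abs_det_fderiv_smul volume hms hd (mob_injOn ha) g
  simp only [mob_image ha, det_aux] at h1 h2
  exact ⟨h1, h2⟩

/-- the kernel factor times the weight -/
lemma jac {α : ℝ} {a ζ : ℂ} (ha : ‖a‖ < 1) (hz : ‖ζ‖ < 1) :
    ((‖dmob a ζ‖ ^ 2 : ℝ) : ℂ) * ((starRingEnd ℂ) (1 / (1 - mob a ζ * (starRingEnd ℂ) a) ^ ((α : ℂ) + 2)) *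
      (((1 - ‖mob a ζ‖ ^ 2) ^ α : ℝ) : ℂ)) =
    ((((1 - ‖a‖ ^ 2) ^ (α + 2))⁻¹ : ℝ) : ℂ) * ((1 - mob a ζ * (starRingEnd ℂ) a) ^ ((α : ℂ) + 2) *
      (((1 - ‖ζ‖ ^ 2) ^ α : ℝ) : ℂ)) := by
  have hd := den_ne ha hz
  have h2 : 0 < ‖1 + (starRingEnd ℂ) a * ζ‖ := by simpa using hd
  have h3 : 0 < 1 - ‖a‖ ^ 2 := by nlinarith [norm_nonneg a]
  have h4 : 0 < 1 - ‖ζ‖ ^ 2 := by nlinarith [norm_nonneg ζ]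
  have hX : 1 - mob a ζ * (starRingEnd ℂ) a ≠ 0 :=
    ne_of_re_pos (re_pos_of (norm_mul_lt (mob_mem ha hz).le ha))
  have hXn : ‖1 - mob a ζ * (starRingEnd ℂ) a‖ = (1 - ‖a‖ ^ 2) / ‖1 + (starRingEnd ℂ) a * ζ‖ := by
    rw [one_sub_mob ha hz, norm_div, aa_eq, Complex.norm_real, Real.norm_of_nonneg h3.le]
  set X := 1 - mob a ζ * (starRingEnd ℂ) a
  have hs : ((α : ℂ) + 2) = ((α + 2 : ℝ) : ℂ) := by push_cast; ring
  have hP : X ^ ((α : ℂ) + 2) ≠ 0 := by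
    rw [Complex.cpow_ne_zero_iff]; exact Or.inl hX
  have hPP : X ^ ((α : ℂ) + 2) * (starRingEnd ℂ) (X ^ ((α : ℂ) + 2)) =
      (((‖X‖ ^ (α + 2)) ^ 2 : ℝ) : ℂ) := by
    rw [Complex.mul_conj, Complex.normSq_eq_norm_sq, hs, Complex.norm_cpow_real]
  have hR : ‖dmob a ζ‖ ^ 2 * (1 - ‖mob a ζ‖ ^ 2) ^ α =
      ((1 - ‖a‖ ^ 2) ^ (α + 2))⁻¹ * (‖X‖ ^ (α + 2)) ^ 2 * (1 - ‖ζ‖ ^ 2) ^ α := by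
    rw [one_sub_norm_mob ha hz, hXn, dmob, norm_div, aa_eq, Complex.norm_real,
      Real.norm_of_nonneg h3.le, norm_pow]
    generalize 1 - ‖a‖ ^ 2 = A at *
    generalize 1 - ‖ζ‖ ^ 2 = B at *
    generalize ‖1 + (starRingEnd ℂ) a * ζ‖ = Q at *
    have hQ : 0 < Q ^ α := by positivity
    have hA : 0 < A ^ α := by positivity
    rw [Real.div_rpow (by positivity) (by positivity), Real.mul_rpow h3.le h4.le,
      Real.div_rpow h3.le h2.le, Real.rpow_add h3, Real.rpow_add h2, Real.rpow_two, Real.rpow_two,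
      pow_two Q, Real.mul_rpow h2.le h2.le]
    field_simp
  rw [map_div₀, map_one]
  have hP' : (starRingEnd ℂ) (X ^ ((α : ℂ) + 2)) ≠ 0 := by simpa using hP
  have hR' := congrArg (fun x : ℝ => (x : ℂ)) hR
  simp only [Complex.ofReal_mul] at hR'
  rw [← hPP] at hR'
  generalize (starRingEnd ℂ) (X ^ ((α : ℂ) + 2)) = Y at *
  apply mul_left_cancel₀ hP'
  have hY : Y * (1 / Y) = 1 := by field_simp
  linear_combination hR' + ((‖dmob a ζ‖ ^ 2 : ℝ) : ℂ) * (((1 - ‖mob a ζ‖ ^ 2) ^ α : ℝ) : ℂ) * hY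

lemma factor_order {f : ℂ → ℂ} {a : ℂ} (ha : a ∈ unitDisk) (n : ℕ) (hf : DifferentiableOn ℂ f unitDisk)
    (h : (n : ℕ∞) ≤ analyticOrderAt f a) :
    ∃ g, DifferentiableOn ℂ g unitDisk ∧ ∀ z ∈ unitDisk, f z = (z - a) ^ n * g z := by
  have ho : IsOpen unitDisk := isOpen_ball
  induction n generalizing f with
  | zero => exact ⟨f, hf, by simp⟩
  | succ n ih =>
    have hfa : AnalyticAt ℂ f a := hf.analyticAt (ho.mem_nhds ha)
    have hg : DifferentiableOn ℂ (dslope f a) unitDisk :=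
      (Complex.differentiableOn_dslope (ho.mem_nhds ha)).2 hf
    have hga : AnalyticAt ℂ (dslope f a) a := hg.analyticAt (ho.mem_nhds ha)
    have h0 : f a = 0 := by
      rw [← AnalyticAt.analyticOrderAt_ne_zero hfa]
      intro h'
      rw [h'] at h
      simp at h
    have he : f = (fun z => z - a) * dslope f a := by
      ext z
      have := sub_smul_dslope f a z
      simp only [smul_eq_mul, h0, sub_zero] at this
      simp [this]
    have hid : AnalyticAt ℂ (fun z : ℂ => z - a) a := by fun_prop
    have h1 : analyticOrderAt (fun z : ℂ => z - a) a = 1 := by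
      have := AnalyticAt.analyticOrderAt_sub_eq_one_of_deriv_ne_zero (f := fun z : ℂ => z) (x := a) (by fun_prop) (by simp)
      simpa using this
    have h2 := analyticOrderAt_mul hid hga
    rw [← he, h1] at h2
    rw [h2] at h
    have h3 : (n : ℕ∞) ≤ analyticOrderAt (dslope f a) a := by
      push_cast at h
      rw [add_comm] at h
      exact (ENat.add_le_add_iff_left (by simp)).1 h
    obtain ⟨g, hg1, hg2⟩ := ih hg h3
    refine ⟨g, hg1, fun z hz => ?_⟩
    have := congrFun he z
    rw [this, Pi.mul_apply, hg2 z hz]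
    ring

lemma factor {f : ℂ → ℂ} {a : ℂ} (ha : a ∈ unitDisk) (n : ℕ) (hf : DifferentiableOn ℂ f unitDisk)
    (h : ∀ j < n, iteratedDeriv j f a = 0) :
    ∃ g, DifferentiableOn ℂ g unitDisk ∧ ∀ z ∈ unitDisk, f z = (z - a) ^ n * g z := by
  refine factor_order ha n hf ?_
  rw [natCast_le_analyticOrderAt_iff_iteratedDeriv_eq_zero]
  · exact h
  · exact hf.analyticAt (isOpen_ball.mem_nhds ha)

lemma weight_cont (α : ℝ) : ContinuousOn (fun z : ℂ => (1 - ‖z‖ ^ 2) ^ α) unitDisk := by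
  refine ContinuousOn.rpow_const (by fun_prop) ?_
  intro z hz
  left
  have := mem_uD.1 hz
  nlinarith [norm_nonneg z]

lemma bdd_int {α : ℝ} (hα : -1 < α) {f B : ℂ → ℂ} (hf : DifferentiableOn ℂ f unitDisk)
    (hi : IntegrableOn (fun z => ‖f z‖ ^ 2 * (1 - ‖z‖ ^ 2) ^ α) unitDisk)
    (hB : ContinuousOn B unitDisk) (M : ℝ) (hM : ∀ z ∈ unitDisk, ‖B z‖ ≤ M) :
    IntegrableOn (fun z => f z * B z * (((1 - ‖z‖ ^ 2) ^ α : ℝ) : ℂ)) unitDisk := by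
  have hms : MeasurableSet unitDisk := measurableSet_ball
  refine Integrable.mono' ((hi.add (weight_int α hα).1).const_mul M) ?_ ?_
  · refine ContinuousOn.aestronglyMeasurable ?_ hms
    exact (hf.continuousOn.mul hB).mul (Complex.continuous_ofReal.comp_continuousOn (weight_cont α))
  · filter_upwards [ae_restrict_mem hms] with z hz
    have h1 := mem_uD.1 hz
    have h4 : 0 < 1 - ‖z‖ ^ 2 := by nlinarith [norm_nonneg z]
    have h5 : 0 < (1 - ‖z‖ ^ 2) ^ α := by positivity
    rw [norm_mul, norm_mul, Complex.norm_real, Real.norm_of_nonneg h5.le]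
    have h6 := hM z hz
    have h7 : ‖f z‖ ≤ ‖f z‖ ^ 2 + 1 := by nlinarith [sq_nonneg (‖f z‖ - 1)]
    have h8 : ‖f z‖ * ‖B z‖ ≤ (‖f z‖ ^ 2 + 1) * M := 
      mul_le_mul h7 h6 (norm_nonneg _) (by positivity)
    calc _ ≤ (‖f z‖ ^ 2 + 1) * M * (1 - ‖z‖ ^ 2) ^ α := by gcongr
      _ = _ := by simp [Pi.add_apply]; ring

lemma ker_diffAt {w z : ℂ} (hw : ‖w‖ < 1) (hz : ‖z‖ ≤ 1) (s : ℂ) :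
    DifferentiableAt ℂ (fun z => (1 - z * (starRingEnd ℂ) w) ^ s) z := by
  refine DifferentiableAt.cpow (by fun_prop) (by fun_prop) ?_
  exact Or.inl (re_pos_of (norm_mul_lt hz hw))

lemma ker_ne {w z : ℂ} (hw : ‖w‖ < 1) (hz : ‖z‖ ≤ 1) (s : ℂ) :
    (1 - z * (starRingEnd ℂ) w) ^ s ≠ 0 := by
  rw [Complex.cpow_ne_zero_iff]
  exact Or.inl (ne_of_re_pos (re_pos_of (norm_mul_lt hz hw)))

lemma mob_neg (a z : ℂ) : mob (-a) z = (z - a) / (1 - z * (starRingEnd ℂ) a) := by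
  rw [mob]; simp; ring

lemma ker1_diffAt {a z : ℂ} (ha : ‖a‖ < 1) (hz : ‖z‖ ≤ 1) (s : ℂ) (j : ℕ) :
    DifferentiableAt ℂ (fun z => ((z - a) / (1 - z * (starRingEnd ℂ) a)) ^ j *
      (1 / (1 - z * (starRingEnd ℂ) a) ^ s)) z := by
  have h1 := ker_diffAt ha hz s
  have h2 := ker_ne ha hz s
  have h3 : 1 - z * (starRingEnd ℂ) a ≠ 0 := ne_of_re_pos (re_pos_of (norm_mul_lt hz ha))
  refine DifferentiableAt.mul ?_ ((differentiableAt_const _).div h1 h2)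
  have h4 : DifferentiableAt ℂ (fun z : ℂ => (z - a) / (1 - z * (starRingEnd ℂ) a)) z :=
    DifferentiableAt.div (by fun_prop) (by fun_prop) h3
  exact h4.pow j

lemma bdd_of_diff {B : ℂ → ℂ} (h : ∀ z : ℂ, ‖z‖ ≤ 1 → DifferentiableAt ℂ B z) :
    DifferentiableOn ℂ B unitDisk ∧ ∃ M, ∀ z ∈ unitDisk, ‖B z‖ ≤ M := by
  constructor
  · intro z hz
    exact (h z (mem_uD.1 hz).le).differentiableWithinAt
  · obtain ⟨M, hM⟩ := (isCompact_closedBall (0:ℂ) 1).exists_bound_of_continuousOn (f := B) (by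
      intro z hz
      exact (h z (by simpa using hz)).continuousAt.continuousWithinAt)
    exact ⟨M, fun z hz => hM z (by simpa using (mem_uD.1 hz).le)⟩

lemma core {α : ℝ} (hα : -1 < α) {a : ℂ} (ha : ‖a‖ < 1) {f : ℂ → ℂ} (hf : DifferentiableOn ℂ f unitDisk)
    (hi : IntegrableOn (fun z => ‖f z‖ ^ 2 * (1 - ‖z‖ ^ 2) ^ α) unitDisk) (j : ℕ) :
    IntegrableOn (fun z => f z * (starRingEnd ℂ) (((z - a) / (1 - z * (starRingEnd ℂ) a)) ^ j *
      (1 / (1 - z * (starRingEnd ℂ) a) ^ ((α : ℂ) + 2))) * (((1 - ‖z‖ ^ 2) ^ α : ℝ) : ℂ)) unitDisk ∧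
    IntegrableOn (fun ζ => ((((1 - ‖a‖ ^ 2) ^ (α + 2))⁻¹ : ℝ) : ℂ) * (f (mob a ζ) * (1 - mob a ζ * (starRingEnd ℂ) a) ^ ((α : ℂ) + 2) * (starRingEnd ℂ) ζ ^ j * (((1 - ‖ζ‖ ^ 2) ^ α : ℝ) : ℂ))) unitDisk ∧
    ∫ z in unitDisk, f z * (starRingEnd ℂ) (((z - a) / (1 - z * (starRingEnd ℂ) a)) ^ j *
      (1 / (1 - z * (starRingEnd ℂ) a) ^ ((α : ℂ) + 2))) * (((1 - ‖z‖ ^ 2) ^ α : ℝ) : ℂ) =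
    ∫ ζ in unitDisk, ((((1 - ‖a‖ ^ 2) ^ (α + 2))⁻¹ : ℝ) : ℂ) * (f (mob a ζ) * (1 - mob a ζ * (starRingEnd ℂ) a) ^ ((α : ℂ) + 2) * (starRingEnd ℂ) ζ ^ j * (((1 - ‖ζ‖ ^ 2) ^ α : ℝ) : ℂ)) := by
  have hms : MeasurableSet unitDisk := measurableSet_ball
  obtain ⟨hd, M, hM⟩ := bdd_of_diff (fun z hz => ker1_diffAt ha hz ((α : ℂ) + 2) j)
  have h1 := bdd_int hα hf hi (Complex.continuous_conj.comp_continuousOn hd.continuousOn) M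
    (fun z hz => by rw [Function.comp_apply, RCLike.norm_conj]; exact hM z hz)
  obtain ⟨c1, c2⟩ := cov ha (fun z => f z * (starRingEnd ℂ) (((z - a) / (1 - z * (starRingEnd ℂ) a)) ^ j *
      (1 / (1 - z * (starRingEnd ℂ) a) ^ ((α : ℂ) + 2))) * (((1 - ‖z‖ ^ 2) ^ α : ℝ) : ℂ))
  have key : EqOn (fun ζ => ‖dmob a ζ‖ ^ 2 • (fun z => f z * (starRingEnd ℂ) (((z - a) / (1 - z * (starRingEnd ℂ) a)) ^ j *
      (1 / (1 - z * (starRingEnd ℂ) a) ^ ((α : ℂ) + 2))) * (((1 - ‖z‖ ^ 2) ^ α : ℝ) : ℂ)) (mob a ζ))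
      (fun ζ => ((((1 - ‖a‖ ^ 2) ^ (α + 2))⁻¹ : ℝ) : ℂ) * (f (mob a ζ) * (1 - mob a ζ * (starRingEnd ℂ) a) ^ ((α : ℂ) + 2) * (starRingEnd ℂ) ζ ^ j * (((1 - ‖ζ‖ ^ 2) ^ α : ℝ) : ℂ))) unitDisk := by
    intro ζ hζ
    have hz := mem_uD.1 hζ
    have h2 := jac (α := α) ha hz
    have h3 := mob_inv ha hz
    rw [mob_neg] at h3
    simp only
    rw [h3, Complex.real_smul, map_mul, map_pow]
    linear_combination f (mob a ζ) * (starRingEnd ℂ) ζ ^ j * h2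
  refine ⟨h1, ?_, ?_⟩
  · exact (integrableOn_congr_fun key hms).1 (c1.1 h1)
  · rw [c2]
    exact setIntegral_congr_fun hms key

lemma mob_diffOn {a : ℂ} (ha : ‖a‖ < 1) : DifferentiableOn ℂ (mob a) unitDisk :=
  fun _ hz => (mob_hasDeriv ha (mem_uD.1 hz)).differentiableAt.differentiableWithinAt

lemma mob_maps {a : ℂ} (ha : ‖a‖ < 1) : MapsTo (mob a) unitDisk unitDisk :=
  fun _ hz => mem_uD.2 (mob_mem ha (mem_uD.1 hz))

lemma ker_mob_diffOn {a : ℂ} (ha : ‖a‖ < 1) (s : ℂ) :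
    DifferentiableOn ℂ (fun ζ => (1 - mob a ζ * (starRingEnd ℂ) a) ^ s) unitDisk := by
  have h : DifferentiableOn ℂ (fun z => (1 - z * (starRingEnd ℂ) a) ^ s) unitDisk :=
    fun z hz => (ker_diffAt ha (mem_uD.1 hz).le s).differentiableWithinAt
  exact h.comp (mob_diffOn ha) (mob_maps ha)

lemma orth {α : ℝ} (hα : -1 < α) {a : ℂ} (ha : ‖a‖ < 1) {f : ℂ → ℂ} (hf : DifferentiableOn ℂ f unitDisk)
    (hi : IntegrableOn (fun z => ‖f z‖ ^ 2 * (1 - ‖z‖ ^ 2) ^ α) unitDisk) {n j : ℕ} (hj : j < n)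
    (hv : ∀ j < n, iteratedDeriv j f a = 0) :
    ∫ z in unitDisk, f z * (starRingEnd ℂ) (((z - a) / (1 - z * (starRingEnd ℂ) a)) ^ j *
      (1 / (1 - z * (starRingEnd ℂ) a) ^ ((α : ℂ) + 2))) * (((1 - ‖z‖ ^ 2) ^ α : ℝ) : ℂ) = 0 := by
  have hms : MeasurableSet unitDisk := measurableSet_ball
  rw [(core hα ha hf hi j).2.2, integral_const_mul]
  obtain ⟨g, hg, hfg⟩ := factor (mem_uD.2 ha) n hf hv
  have hd : DifferentiableOn ℂ (fun ζ : ℂ => ζ ^ (n - j) * (((1 - a * (starRingEnd ℂ) a) / (1 + (starRingEnd ℂ) a * ζ)) ^ n * g (mob a ζ) * (1 - mob a ζ * (starRingEnd ℂ) a) ^ ((α : ℂ) + 2))) unitDisk := by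
    refine DifferentiableOn.mul (by fun_prop) (DifferentiableOn.mul (DifferentiableOn.mul ?_ (hg.comp (mob_diffOn ha) (mob_maps ha))) (ker_mob_diffOn ha _))
    refine (DifferentiableOn.div (by fun_prop) (by fun_prop) ?_).pow n
    intro z hz
    exact den_ne ha (mem_uD.1 hz)
  have h0 := mv0 _ hd (by simp [Nat.sub_ne_zero_of_lt hj]) (fun r => r ^ (2 * j) * (1 - r ^ 2) ^ α)
  rw [mul_eq_zero]
  right
  rw [← h0]
  refine setIntegral_congr_fun hms ?_
  intro ζ hζ
  have hz := mem_uD.1 hζ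
  have h2 := den_ne ha hz
  have h3 : mob a ζ - a = ζ * ((1 - a * (starRingEnd ℂ) a) / (1 + (starRingEnd ℂ) a * ζ)) := by
    have h' : 1 + ζ * (starRingEnd ℂ) a ≠ 0 := by rwa [mul_comm] at h2
    rw [mob]; field_simp; ring
  have h4 : ζ ^ n * (starRingEnd ℂ) ζ ^ j = ζ ^ (n - j) * ((‖ζ‖ ^ (2 * j) : ℝ) : ℂ) := by
    obtain ⟨k, rfl⟩ := Nat.exists_eq_add_of_lt hj
    have : ((‖ζ‖ ^ (2 * j) : ℝ) : ℂ) = (ζ * (starRingEnd ℂ) ζ) ^ j := by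
      rw [Complex.mul_conj, Complex.normSq_eq_norm_sq, pow_mul]; push_cast; ring
    have e : j + k + 1 - j = k + 1 := by omega
    rw [this, e, mul_pow]; ring
  simp only
  rw [hfg _ (mob_maps ha hζ), h3, mul_pow, Complex.ofReal_mul]
  linear_combination ((1 - a * (starRingEnd ℂ) a) / (1 + (starRingEnd ℂ) a * ζ)) ^ n * g (mob a ζ) * (1 - mob a ζ * (starRingEnd ℂ) a) ^ ((α : ℂ) + 2) * (((1 - ‖ζ‖ ^ 2) ^ α : ℝ) : ℂ) * h4

lemma repro {α : ℝ} (hα : -1 < α) {a : ℂ} (ha : ‖a‖ < 1) {f : ℂ → ℂ} (hf : DifferentiableOn ℂ f unitDisk)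
    (hi : IntegrableOn (fun z => ‖f z‖ ^ 2 * (1 - ‖z‖ ^ 2) ^ α) unitDisk) :
    ∫ z in unitDisk, f z * (starRingEnd ℂ)
      (1 / (1 - z * (starRingEnd ℂ) a) ^ ((α : ℂ) + 2)) * (((1 - ‖z‖ ^ 2) ^ α : ℝ) : ℂ) = f a * ((Real.pi / (α + 1) : ℝ) : ℂ) := by
  obtain ⟨-, h2, h3⟩ := core hα ha hf hi 0
  have hA : 0 < 1 - ‖a‖ ^ 2 := by nlinarith [norm_nonneg a]
  have hAs : 0 < (1 - ‖a‖ ^ 2) ^ (α + 2) := by positivity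
  simp only [pow_zero, one_mul, mul_one] at h2 h3
  rw [h3]
  set c : ℂ := ((((1 - ‖a‖ ^ 2) ^ (α + 2))⁻¹ : ℝ) : ℂ) with hc
  have hG : DifferentiableOn ℂ (fun ζ => c * (f (mob a ζ) * (1 - mob a ζ * (starRingEnd ℂ) a) ^ ((α : ℂ) + 2)) - f a) unitDisk := by
    refine ((DifferentiableOn.mul (hf.comp (mob_diffOn ha) (mob_maps ha)) (ker_mob_diffOn ha _)).const_mul c).sub_const _
  have hs : ((α : ℂ) + 2) = ((α + 2 : ℝ) : ℂ) := by push_cast; ring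
  have h0 := mv0 _ hG (by
    have : mob a 0 = a := by simp [mob]
    rw [this, aa_eq, hs, ← Complex.ofReal_cpow hA.le, hc, Complex.ofReal_inv]
    have : (((1 - ‖a‖ ^ 2) ^ (α + 2) : ℝ) : ℂ) ≠ 0 := by exact_mod_cast hAs.ne'
    field_simp
    ring) (fun r => (1 - r ^ 2) ^ α)
  have hw := weight_int α hα
  have hw1 : IntegrableOn (fun z : ℂ => f a * (((1 - ‖z‖ ^ 2) ^ α : ℝ) : ℂ)) unitDisk := (hw.1.ofReal).const_mul _
  have e : ∀ ζ : ℂ, (c * (f (mob a ζ) * (1 - mob a ζ * (starRingEnd ℂ) a) ^ ((α : ℂ) + 2)) - f a) * (((1 - ‖ζ‖ ^ 2) ^ α : ℝ) : ℂ) = c * (f (mob a ζ) * (1 - mob a ζ * (starRingEnd ℂ) a) ^ ((α : ℂ) + 2) * (((1 - ‖ζ‖ ^ 2) ^ α : ℝ) : ℂ)) - f a * (((1 - ‖ζ‖ ^ 2) ^ α : ℝ) : ℂ) := by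
    intro ζ; ring
  simp only [e] at h0
  rw [integral_sub h2 hw1, sub_eq_zero] at h0
  rw [h0, integral_const_mul, integral_complex_ofReal, hw.2]

lemma iter_ker (s : ℝ) (hs : 0 < s) (k : ℕ) (x : ℂ) (hx : ‖x‖ < 1) :
    iteratedDeriv k (fun x : ℂ => (1 - x) ^ (-(s : ℂ))) x =
      ((Real.Gamma (s + k) / Real.Gamma s : ℝ) : ℂ) * (1 - x) ^ (-(s : ℂ) - k) := by
  have hG := (Real.Gamma_pos_of_pos hs).ne'
  induction k generalizing x with
  | zero => simp [hG]
  | succ k ih =>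
    rw [iteratedDeriv_succ]
    have he : iteratedDeriv k (fun x : ℂ => (1 - x) ^ (-(s : ℂ))) =ᶠ[nhds x] fun x =>
      ((Real.Gamma (s + k) / Real.Gamma s : ℝ) : ℂ) * (1 - x) ^ (-(s : ℂ) - k) := by
      have : Metric.ball (0:ℂ) 1 ∈ nhds x := isOpen_ball.mem_nhds (by simpa using hx)
      filter_upwards [this] with y hy
      exact ih y (by simpa using hy)
    rw [he.deriv_eq]
    have h1 : HasDerivAt (fun x : ℂ => 1 - x) (-1) x := by
      simpa using (hasDerivAt_id x).const_sub 1
    have h2 := (h1.cpow_const (c := -(s : ℂ) - k) (Or.inl (re_pos_of hx))).const_mul ((Real.Gamma (s + k) / Real.Gamma s : ℝ) : ℂ)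
    rw [h2.deriv]
    have hk : 0 < s + k := by positivity
    have h3 : Real.Gamma (s + (k + 1 : ℕ)) = (s + k) * Real.Gamma (s + k) := by
      rw [← Real.Gamma_add_one hk.ne']; push_cast; ring_nf
    rw [h3]
    have e : -(s : ℂ) - (k + 1 : ℕ) = -(s : ℂ) - k - 1 := by push_cast; ring
    rw [e]
    push_cast
    ring

lemma taylor_ker (s : ℝ) (hs : 0 < s) (n : ℕ) : ∃ q : ℂ → ℂ, AnalyticAt ℂ q 0 ∧ ∀ x : ℂ,
    1 / (1 - x) ^ (s : ℂ) - ∑ j ∈ Finset.range n, ((Real.Gamma (s + j) / (Real.Gamma s * (Nat.factorial j)) : ℝ) : ℂ) * x ^ j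
      = x ^ n * q x := by
  have hf : AnalyticAt ℂ (fun x : ℂ => (1 - x) ^ (-(s : ℂ))) 0 := by
    refine AnalyticAt.cpow (by fun_prop) (by fun_prop) ?_
    simp
  obtain ⟨q, hq, h⟩ := hf.exists_eq_sum_add_pow_mul n
  refine ⟨q, hq, fun x => ?_⟩
  have h1 := h x
  rw [one_div, ← Complex.cpow_neg]
  simp only [sub_zero, smul_eq_mul] at h1
  rw [h1, add_comm, add_sub_assoc, ← Finset.sum_sub_distrib, Finset.sum_eq_zero, add_zero]
  intro j _
  rw [iter_ker s hs j 0 (by simp)]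
  have : (Nat.factorial j : ℂ) ≠ 0 := by exact_mod_cast Nat.factorial_ne_zero j
  simp
  field_simp
  ring

lemma cpow_id {A : ℝ} (hA : 0 < A) {U0 U1 U2 U3 : ℂ} (h0 : 0 < U0.re) (h1 : 0 < U1.re)
    (h2 : 0 < U2.re) (h3 : 0 < U3.re) (h : (A : ℂ) * U0 = U1 * U2 * U3) (s : ℝ) :
    ((A ^ s : ℝ) : ℂ) * U0 ^ (s : ℂ) = U1 ^ (s : ℂ) * U2 ^ (s : ℂ) * U3 ^ (s : ℂ) := by
  have n0 := ne_of_re_pos h0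
  have n1 := ne_of_re_pos h1
  have n2 := ne_of_re_pos h2
  have n3 := ne_of_re_pos h3
  have nA : (A : ℂ) ≠ 0 := by exact_mod_cast hA.ne'
  have hlog : log U1 + log U2 + log U3 - log U0 - log A = 0 := by
    have he : exp (log U1 + log U2 + log U3 - log U0 - log A) = 1 := by
      rw [exp_sub, exp_sub, exp_add, exp_add, exp_log n0, exp_log n1, exp_log n2, exp_log n3, exp_log nA, ← h]
      field_simp
    obtain ⟨m, hm⟩ := Complex.exp_eq_one_iff.1 he
    have him := congrArg Complex.im hm
    rw [← Complex.ofReal_log hA.le] at him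
    simp at him
    simp only [Complex.log_im] at him
    have a0 := abs_lt.1 (Complex.abs_arg_lt_pi_div_two_iff.2 (Or.inl h0))
    have a1 := abs_lt.1 (Complex.abs_arg_lt_pi_div_two_iff.2 (Or.inl h1))
    have a2 := abs_lt.1 (Complex.abs_arg_lt_pi_div_two_iff.2 (Or.inl h2))
    have a3 := abs_lt.1 (Complex.abs_arg_lt_pi_div_two_iff.2 (Or.inl h3))
    have hp := Real.pi_pos
    have m1 : (m : ℝ) < 1 := by
      by_contra hc
      push Not at hc
      nlinarith
    have m2 : (-1 : ℝ) < m := by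
      by_contra hc
      push Not at hc
      nlinarith
    have m0 : m = 0 := by
      have m1' : m < 1 := by exact_mod_cast m1
      have m2' : -1 < m := by exact_mod_cast m2
      omega
    rw [hm, m0]; simp
  rw [Complex.ofReal_cpow hA.le, cpow_def_of_ne_zero n0, cpow_def_of_ne_zero n1, cpow_def_of_ne_zero n2,
    cpow_def_of_ne_zero n3, cpow_def_of_ne_zero nA, ← exp_add, ← exp_add, ← exp_add]
  congr 1
  linear_combination (-(s : ℂ)) * hlog

lemma ker_id {α : ℝ} {a z w : ℂ} (ha : ‖a‖ < 1) (hz : ‖z‖ < 1) (hw : ‖w‖ < 1) :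
    1 / (1 - z * (starRingEnd ℂ) w) ^ ((α : ℂ) + 2) =
      (((1 - ‖a‖ ^ 2) ^ (α + 2) : ℝ) : ℂ) /
            ((1 - z * (starRingEnd ℂ) a) ^ ((α : ℂ) + 2) *
              (1 - a * (starRingEnd ℂ) w) ^ ((α : ℂ) + 2)) *
      (1 / (1 - (z - a) / (1 - z * (starRingEnd ℂ) a) *
        (((starRingEnd ℂ) w - (starRingEnd ℂ) a) / (1 - a * (starRingEnd ℂ) w))) ^ ((α : ℂ) + 2)) := by
  have hs : ((α : ℂ) + 2) = ((α + 2 : ℝ) : ℂ) := by push_cast; ring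
  have ha' : ‖-a‖ < 1 := by simpa using ha
  have hA : 0 < 1 - ‖a‖ ^ 2 := by nlinarith [norm_nonneg a]
  have r0 := re_pos_of (norm_mul_lt hz.le hw)
  have r1 := re_pos_of (norm_mul_lt hz.le ha)
  have r2 := re_pos_of (norm_mul_lt ha.le hw)
  have r3 := re_pos_of (norm_mul_lt (mob_mem ha' hz).le (mob_mem ha' hw))
  have e3 : mob (-a) z * (starRingEnd ℂ) (mob (-a) w) = (z - a) / (1 - z * (starRingEnd ℂ) a) *
        (((starRingEnd ℂ) w - (starRingEnd ℂ) a) / (1 - a * (starRingEnd ℂ) w)) := by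
    rw [mob_neg, mob_neg, map_div₀, map_sub, map_sub, map_one, map_mul, Complex.conj_conj, mul_comm ((starRingEnd ℂ) w) a]
  rw [e3] at r3
  have n1 := ne_of_re_pos r1
  have n2 := ne_of_re_pos r2
  have hmul : ((1 - ‖a‖ ^ 2 : ℝ) : ℂ) * (1 - z * (starRingEnd ℂ) w) = (1 - z * (starRingEnd ℂ) a) *
     (1 - a * (starRingEnd ℂ) w) * (1 - (z - a) / (1 - z * (starRingEnd ℂ) a) *
        (((starRingEnd ℂ) w - (starRingEnd ℂ) a) / (1 - a * (starRingEnd ℂ) w))) := by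
    rw [← aa_eq]
    have n1' : 1 - (starRingEnd ℂ) a * z ≠ 0 := by rwa [mul_comm] at n1
    have n2' : 1 - (starRingEnd ℂ) w * a ≠ 0 := by rwa [mul_comm] at n2
    field_simp
    ring
  have key := cpow_id hA r0 r1 r2 r3 hmul (α + 2)
  rw [← hs] at key
  have c0 := ker_ne hw hz.le ((α : ℂ) + 2)
  have c1 := ker_ne ha hz.le ((α : ℂ) + 2)
  have c2 := ker_ne hw ha.le ((α : ℂ) + 2)
  have c3 : (1 - (z - a) / (1 - z * (starRingEnd ℂ) a) *
        (((starRingEnd ℂ) w - (starRingEnd ℂ) a) / (1 - a * (starRingEnd ℂ) w))) ^ ((α : ℂ) + 2) ≠ 0 := by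
    rw [Complex.cpow_ne_zero_iff]
    exact Or.inl (ne_of_re_pos r3)
  generalize (1 - (z - a) / (1 - z * (starRingEnd ℂ) a) *
        (((starRingEnd ℂ) w - (starRingEnd ℂ) a) / (1 - a * (starRingEnd ℂ) w))) ^ ((α : ℂ) + 2) = P3 at *
  generalize (1 - z * (starRingEnd ℂ) w) ^ ((α : ℂ) + 2) = P0 at *
  generalize (1 - z * (starRingEnd ℂ) a) ^ ((α : ℂ) + 2) = P1 at *
  generalize (1 - a * (starRingEnd ℂ) w) ^ ((α : ℂ) + 2) = P2 at *
  generalize (((1 - ‖a‖ ^ 2) ^ (α + 2) : ℝ) : ℂ) = P4 at *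
  field_simp
  linear_combination -key

lemma intOn_dSigma {E : Type*} [NormedAddCommGroup E] (f : ℂ → E) :
    IntegrableOn f unitDisk dSigma ↔ IntegrableOn f unitDisk := by
  unfold IntegrableOn dSigma
  rw [Measure.restrict_smul]
  refine integrable_smul_measure ?_ ENNReal.ofReal_ne_top
  have := Real.pi_pos
  simp [this]

lemma int_dSigma (f : ℂ → ℂ) :
    ∫ z in unitDisk, f z ∂dSigma = ((1 / Real.pi : ℝ) : ℂ) * ∫ z in unitDisk, f z := by
  unfold dSigma
  rw [Measure.restrict_smul, integral_smul_measure, ENNReal.toReal_ofReal (by positivity)]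
  simp

lemma memA2_hi {α : ℝ} (hα : -1 < α) {f : ℂ → ℂ}
    (h : MemA2 (fun z => (α + 1) * (1 - ‖z‖ ^ 2) ^ α) f) :
    IntegrableOn (fun z => ‖f z‖ ^ 2 * (1 - ‖z‖ ^ 2) ^ α) unitDisk := by
  have h2 := ((intOn_dSigma _).1 h.2)
  have h3 := Integrable.const_mul h2 (α + 1)⁻¹
  have : α + 1 ≠ 0 := by linarith
  refine h3.congr (Filter.Eventually.of_forall fun z => ?_)
  simp only
  field_simp

lemma memA2_of_bdd {α : ℝ} (hα : -1 < α) {f : ℂ → ℂ}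
    (h : ∀ z : ℂ, ‖z‖ ≤ 1 → DifferentiableAt ℂ f z) :
    MemA2 (fun z => (α + 1) * (1 - ‖z‖ ^ 2) ^ α) f := by
  obtain ⟨h1, M, hM⟩ := bdd_of_diff h
  refine ⟨h1, (intOn_dSigma _).2 ?_⟩
  have hms : MeasurableSet unitDisk := measurableSet_ball
  have hα1 : 0 < α + 1 := by linarith
  refine Integrable.mono' ((weight_int α hα).1.const_mul (M ^ 2 * (α + 1))) ?_ ?_
  · refine ContinuousOn.aestronglyMeasurable ?_ hms
    exact (h1.continuousOn.norm.pow 2).mul (continuousOn_const.mul (weight_cont α))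
  · filter_upwards [ae_restrict_mem hms] with z hz
    have hz' := mem_uD.1 hz
    have hW : 0 ≤ (1 - ‖z‖ ^ 2) ^ α := Real.rpow_nonneg (by nlinarith [norm_nonneg z]) _
    rw [Real.norm_of_nonneg (by positivity), ← mul_assoc]
    have := hM z hz
    gcongr

/-- Coefficients of the subtracted finite sum in the kernel. -/
def coefK (α : ℝ) (a w : ℂ) (j : ℕ) : ℂ :=
  (((1 - ‖a‖ ^ 2) ^ (α + 2) : ℝ) : ℂ) / (1 - a * (starRingEnd ℂ) w) ^ ((α : ℂ) + 2) *
    ((Real.Gamma (α + 2 + j) / (Real.Gamma (α + 2) * (Nat.factorial j)) : ℝ) : ℂ) *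
    (((starRingEnd ℂ) w - (starRingEnd ℂ) a) / (1 - a * (starRingEnd ℂ) w)) ^ j

lemma KA_expand (α : ℝ) (a w z : ℂ) (n : ℕ) :
      1 / (1 - z * (starRingEnd ℂ) w) ^ ((α : ℂ) + 2) -
        (((1 - ‖a‖ ^ 2) ^ (α + 2) : ℝ) : ℂ) /
            ((1 - z * (starRingEnd ℂ) a) ^ ((α : ℂ) + 2) *
              (1 - a * (starRingEnd ℂ) w) ^ ((α : ℂ) + 2)) *
          ∑ j ∈ Finset.range n,
            ((Real.Gamma (α + 2 + j) / (Real.Gamma (α + 2) * (Nat.factorial j)) : ℝ) : ℂ) *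
              ((z - a) / (1 - z * (starRingEnd ℂ) a)) ^ j *
              (((starRingEnd ℂ) w - (starRingEnd ℂ) a) / (1 - a * (starRingEnd ℂ) w)) ^ j =
      1 / (1 - z * (starRingEnd ℂ) w) ^ ((α : ℂ) + 2) -
        ∑ j ∈ Finset.range n, coefK α a w j * (((z - a) / (1 - z * (starRingEnd ℂ) a)) ^ j *
      (1 / (1 - z * (starRingEnd ℂ) a) ^ ((α : ℂ) + 2))) := by
  congr 1
  rw [Finset.mul_sum]
  refine Finset.sum_congr rfl fun j _ => ?_
  unfold coefK
  rw [div_mul_eq_div_div]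
  ring

lemma KA_vanish {α : ℝ} (hα : -1 < α) {a w : ℂ} (ha : ‖a‖ < 1) (hw : ‖w‖ < 1) (n : ℕ) (K : ℂ → ℂ)
    (hd : DifferentiableOn ℂ K unitDisk)
    (hK : ∀ z, K z = 1 / (1 - z * (starRingEnd ℂ) w) ^ ((α : ℂ) + 2) -
        (((1 - ‖a‖ ^ 2) ^ (α + 2) : ℝ) : ℂ) /
            ((1 - z * (starRingEnd ℂ) a) ^ ((α : ℂ) + 2) *
              (1 - a * (starRingEnd ℂ) w) ^ ((α : ℂ) + 2)) *
          ∑ j ∈ Finset.range n,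
            ((Real.Gamma (α + 2 + j) / (Real.Gamma (α + 2) * (Nat.factorial j)) : ℝ) : ℂ) *
              ((z - a) / (1 - z * (starRingEnd ℂ) a)) ^ j *
              (((starRingEnd ℂ) w - (starRingEnd ℂ) a) / (1 - a * (starRingEnd ℂ) w)) ^ j) :
    ∀ j < n, iteratedDeriv j K a = 0 := by
  have hN : unitDisk ∈ nhds a := isOpen_ball.mem_nhds (mem_uD.2 ha)
  have hKa : AnalyticAt ℂ K a := hd.analyticAt hN
  rw [← natCast_le_analyticOrderAt_iff_iteratedDeriv_eq_zero hKa, natCast_le_analyticOrderAt hKa]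
  obtain ⟨q, hq, hqe⟩ := taylor_ker (α + 2) (by linarith) n
  set c := ((starRingEnd ℂ) w - (starRingEnd ℂ) a) / (1 - a * (starRingEnd ℂ) w) with hc
  have n1 : 1 - a * (starRingEnd ℂ) a ≠ 0 := ne_of_re_pos (re_pos_of (norm_mul_lt ha.le ha))
  have hs : ((α + 2 : ℝ) : ℂ) = (α : ℂ) + 2 := by push_cast; ring
  have hden : AnalyticAt ℂ (fun z : ℂ => 1 - z * (starRingEnd ℂ) a) a := by fun_prop
  have hpsi : AnalyticAt ℂ (fun z : ℂ => (z - a) / (1 - z * (starRingEnd ℂ) a) * c) a :=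
    ((analyticAt_id.sub analyticAt_const).div hden n1).mul analyticAt_const
  refine ⟨fun z => (((1 - ‖a‖ ^ 2) ^ (α + 2) : ℝ) : ℂ) /
            ((1 - z * (starRingEnd ℂ) a) ^ ((α : ℂ) + 2) *
              (1 - a * (starRingEnd ℂ) w) ^ ((α : ℂ) + 2)) * ((c / (1 - z * (starRingEnd ℂ) a)) ^ n *
              q ((z - a) / (1 - z * (starRingEnd ℂ) a) * c)), ?_, ?_⟩
  · refine AnalyticAt.mul (AnalyticAt.div analyticAt_const (AnalyticAt.mul ?_ analyticAt_const) ?_)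
      (AnalyticAt.mul ((analyticAt_const.div hden n1).pow n) ?_)
    · exact AnalyticAt.cpow hden analyticAt_const (Or.inl (re_pos_of (norm_mul_lt ha.le ha)))
    · exact mul_ne_zero (ker_ne ha ha.le _) (ker_ne hw ha.le _)
    · refine AnalyticAt.comp' (g := q) ?_ hpsi
      simpa using hq
  · filter_upwards [hN] with z hz
    have hz' := mem_uD.1 hz
    rw [hK, ker_id ha hz' hw, ← mul_sub, ← hc, smul_eq_mul]
    have h := hqe ((z - a) / (1 - z * (starRingEnd ℂ) a) * c)
    rw [hs] at h
    have h2 : ∑ j ∈ Finset.range n,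
            ((Real.Gamma (α + 2 + j) / (Real.Gamma (α + 2) * (Nat.factorial j)) : ℝ) : ℂ) *
              ((z - a) / (1 - z * (starRingEnd ℂ) a)) ^ j * c ^ j = ∑ j ∈ Finset.range n,
            ((Real.Gamma (α + 2 + j) / (Real.Gamma (α + 2) * (Nat.factorial j)) : ℝ) : ℂ) *
              ((z - a) / (1 - z * (starRingEnd ℂ) a) * c) ^ j := by
      refine Finset.sum_congr rfl fun j _ => ?_
      rw [mul_pow, mul_assoc]
    rw [h2, h]
    clear_value c
    rw [mul_pow, div_pow, div_pow]
    ring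

/-- the explicit kernel for the subspace of A²_α of functions
vanishing at a point a ∈ 𝔻 to order at least n, with coefficients
C_{α,j} = Γ(α+2+j)/(Γ(α+2)·j!). -/
theorem statement15 (α : ℝ) (hα : -1 < α) (a : ℂ) (ha : a ∈ unitDisk)
    (n : ℕ) (hn : 0 < n) (KA : ℂ → ℂ → ℂ)
    (hKA : ∀ z w : ℂ, KA z w =
      1 / (1 - z * (starRingEnd ℂ) w) ^ ((α : ℂ) + 2) -
        (((1 - ‖a‖ ^ 2) ^ (α + 2) : ℝ) : ℂ) /
            ((1 - z * (starRingEnd ℂ) a) ^ ((α : ℂ) + 2) *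
              (1 - a * (starRingEnd ℂ) w) ^ ((α : ℂ) + 2)) *
          ∑ j ∈ Finset.range n,
            ((Real.Gamma (α + 2 + j) / (Real.Gamma (α + 2) * (Nat.factorial j)) : ℝ) : ℂ) *
              ((z - a) / (1 - z * (starRingEnd ℂ) a)) ^ j *
              (((starRingEnd ℂ) w - (starRingEnd ℂ) a) / (1 - a * (starRingEnd ℂ) w)) ^ j) :
    ∀ w ∈ unitDisk,
      MemA2 (fun z => (α + 1) * (1 - ‖z‖ ^ 2) ^ α) (fun z => KA z w) ∧
      (∀ j < n, iteratedDeriv j (fun z => KA z w) a = 0) ∧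
      ∀ f : ℂ → ℂ, MemA2 (fun z => (α + 1) * (1 - ‖z‖ ^ 2) ^ α) f →
        (∀ j < n, iteratedDeriv j f a = 0) →
        ∫ z in unitDisk,
            f z * (starRingEnd ℂ) (KA z w) *
              (((α + 1) * (1 - ‖z‖ ^ 2) ^ α : ℝ) : ℂ) ∂dSigma = f w := by

  intro w hw
  have ha' := mem_uD.1 ha
  have hw' := mem_uD.1 hw
  have hα1 : 0 < α + 1 := by linarith
  have hexp : ∀ z, KA z w = 1 / (1 - z * (starRingEnd ℂ) w) ^ ((α : ℂ) + 2) -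
        ∑ j ∈ Finset.range n, coefK α a w j * (((z - a) / (1 - z * (starRingEnd ℂ) a)) ^ j *
      (1 / (1 - z * (starRingEnd ℂ) a) ^ ((α : ℂ) + 2))) := fun z => by
    rw [hKA, KA_expand]
  have hmem : MemA2 (fun z => (α + 1) * (1 - ‖z‖ ^ 2) ^ α) (fun z => KA z w) := by
    refine memA2_of_bdd hα fun z hz => ?_
    rw [funext hexp]
    refine DifferentiableAt.sub ?_ ?_
    · exact (differentiableAt_const _).div (ker_diffAt hw' hz _) (ker_ne hw' hz _)
    · refine DifferentiableAt.fun_sum fun j _ => ?_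
      exact (ker1_diffAt ha' hz _ j).const_mul _
  refine ⟨hmem, KA_vanish hα ha' hw' n _ hmem.1 (fun z => hKA z w), ?_⟩
  intro f hf hv
  have hi := memA2_hi hα hf
  rw [int_dSigma]
  have hI1 : IntegrableOn (fun z => f z * (starRingEnd ℂ)
      (1 / (1 - z * (starRingEnd ℂ) w) ^ ((α : ℂ) + 2)) * (((1 - ‖z‖ ^ 2) ^ α : ℝ) : ℂ)) unitDisk := by
    simpa only [pow_zero, one_mul] using (core hα hw' hf.1 hi 0).1
  have hI2 := fun j => (core hα ha' hf.1 hi j).1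
  have heq : ∀ z, f z * (starRingEnd ℂ) (KA z w) * (((α + 1) * (1 - ‖z‖ ^ 2) ^ α : ℝ) : ℂ) =
      ((α + 1 : ℝ) : ℂ) * (f z * (starRingEnd ℂ)
      (1 / (1 - z * (starRingEnd ℂ) w) ^ ((α : ℂ) + 2)) * (((1 - ‖z‖ ^ 2) ^ α : ℝ) : ℂ) -
      ∑ j ∈ Finset.range n, (starRingEnd ℂ) (coefK α a w j) *
        (f z * (starRingEnd ℂ) (((z - a) / (1 - z * (starRingEnd ℂ) a)) ^ j *
      (1 / (1 - z * (starRingEnd ℂ) a) ^ ((α : ℂ) + 2))) * (((1 - ‖z‖ ^ 2) ^ α : ℝ) : ℂ))) := by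
    intro z
    rw [hexp, map_sub, map_sum, Complex.ofReal_mul]
    have : ∑ j ∈ Finset.range n, (starRingEnd ℂ) (coefK α a w j) *
        (f z * (starRingEnd ℂ) (((z - a) / (1 - z * (starRingEnd ℂ) a)) ^ j *
      (1 / (1 - z * (starRingEnd ℂ) a) ^ ((α : ℂ) + 2))) * (((1 - ‖z‖ ^ 2) ^ α : ℝ) : ℂ)) =
      (f z * (((1 - ‖z‖ ^ 2) ^ α : ℝ) : ℂ)) * ∑ j ∈ Finset.range n, (starRingEnd ℂ) (coefK α a w j *
        (((z - a) / (1 - z * (starRingEnd ℂ) a)) ^ j *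
      (1 / (1 - z * (starRingEnd ℂ) a) ^ ((α : ℂ) + 2)))) := by
      rw [Finset.mul_sum]
      refine Finset.sum_congr rfl fun j _ => ?_
      rw [map_mul (starRingEnd ℂ) (coefK α a w j)]
      ring
    rw [this]
    ring
  have hval : ∫ z in unitDisk, f z * (starRingEnd ℂ) (KA z w) *
      (((α + 1) * (1 - ‖z‖ ^ 2) ^ α : ℝ) : ℂ) =
      ((α + 1 : ℝ) : ℂ) * (f w * ((Real.pi / (α + 1) : ℝ) : ℂ)) := by
    rw [integral_congr_ae (Filter.Eventually.of_forall heq), integral_const_mul, integral_sub hI1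
      (integrable_finset_sum _ fun j _ => (hI2 j).const_mul _), repro hα hw' hf.1 hi,
      integral_finset_sum _ (fun j _ => (hI2 j).const_mul _), Finset.sum_eq_zero, sub_zero]
    intro j hj
    rw [integral_const_mul, orth hα ha' hf.1 hi (Finset.mem_range.1 hj) hv, mul_zero]
  rw [hval]
  have hpi : (Real.pi : ℂ) ≠ 0 := by exact_mod_cast Real.pi_ne_zero
  have hα2 : (α : ℂ) + 1 ≠ 0 := by exact_mod_cast hα1.ne'
  push_cast
  field_simp

end
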